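/- arXiv:math/0604595 — 2 statements merged into one kernel-verified Lean document; each statement's English description precedes it below -/
import Mathlib

section
/- There is a universal constant C > 0 such that for every centrally-symmetric convex body K ⊂ ℝⁿ of volume 1 which is in Löwner's minimal diameter position and every 1 ≤ s ≤ 2, diam(K) ≤ C n^{1/s} T_s(X_K). -/
open MeasureTheory Real Set
open scoped ENNReal RealInnerProductSpace Pointwise

noncomputable section

namespace GM

abbrev E (n : ℕ) := EuclideanSpace ℝ (Fin n)

variable {n : ℕ}

/-- A centrally-symmetric convex body. -/
def IsConvexBody (K : Set (E n)) : Prop :=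
  IsCompact K ∧ Convex ℝ K ∧ (interior K).Nonempty ∧ K = -K

/-- The Euclidean unit sphere in `E n`. -/
def usphere (n : ℕ) : Set (E n) := Metric.sphere 0 1

/-- Haar probability measure on the unit sphere, realized as the normalized
`(n-1)`-dimensional Hausdorff measure restricted to the sphere. -/
def sphMeasure (n : ℕ) : Measure (E n) :=
  (μH[(n : ℝ) - 1] (usphere n))⁻¹ • (μH[(n : ℝ) - 1]).restrict (usphere n)

/-- The marginal density `g_θ(s) = vol_{n-1}(K ∩ {sθ + θ^⊥})`. -/
def gdens (K : Set (E n)) (θ : E n) (s : ℝ) : ℝ :=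
  (μH[(n : ℝ) - 1] (K ∩ {x : E n | ⟪x, θ⟫ = s})).toReal

/-- The centered Gaussian density with variance `ρ²`. -/
def gauss (ρ s : ℝ) : ℝ :=
  (Real.sqrt (2 * π) * ρ)⁻¹ * Real.exp (-(s ^ 2) / (2 * ρ ^ 2))

/-- Kolmogorov-type distance between even densities. -/
def dKol (f₁ f₂ : ℝ → ℝ) : ℝ :=
  sSup {d | ∃ t > (0 : ℝ), d = |(∫ s in (-t)..t, f₁ s) - ∫ s in (-t)..t, f₂ s|}

/-- Linnik-type distance between densities. -/
def dLin (T : ℝ) (f₁ f₂ : ℝ → ℝ) : ℝ :=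
  sSup {d | ∃ s : ℝ, 0 ≤ s ∧ s ≤ T ∧ d = |f₁ s / f₂ s - 1|}

/-- `ρ_θ = (∫_K ⟨x,θ⟩² dx)^{1/2}`. -/
def rhoDir (K : Set (E n)) (θ : E n) : ℝ :=
  Real.sqrt (∫ x in K, ⟪x, θ⟫ ^ 2)

def rhoMax (K : Set (E n)) : ℝ := sSup (rhoDir K '' usphere n)

def rhoAvg (K : Set (E n)) : ℝ := ∫ θ, rhoDir K θ ∂(sphMeasure n)

/-- `C_iso(K) = ρ_max / ρ_avg`. -/
def Ciso (K : Set (E n)) : ℝ := rhoMax K / rhoAvg K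

/-- Concentration hypothesis (⋆) with parameters `(ρ, A, B, ν, τ)`. -/
def ConcHyp (K : Set (E n)) (ρ A B ν τ : ℝ) : Prop :=
  ∀ t : ℝ, 0 ≤ t → t ≤ 1 →
    volume {x : E n | x ∈ K ∧ t * ρ ≤ |‖x‖ / Real.sqrt n - ρ|} ≤
      ENNReal.ofReal (A * Real.exp (-B * (n : ℝ) ^ ν * t ^ τ))

/-- The modulus of convexity of `K` (w.r.t. the gauge norm of `K`). -/
def modConv (K : Set (E n)) (ε : ℝ) : ℝ :=
  sInf {d | ∃ x y : E n, gauge K x ≤ 1 ∧ gauge K y ≤ 1 ∧ ε ≤ gauge K (x - y) ∧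
    d = 1 - gauge K ((2⁻¹ : ℝ) • (x + y))}

/-- `K` is a `p`-convex body with constant `α`. -/
def IsPConvexBody (K : Set (E n)) (p α : ℝ) : Prop :=
  IsConvexBody K ∧ ∀ ε : ℝ, 0 < ε → ε ≤ 2 → α * ε ^ p ≤ modConv K ε

/-- Löwner's minimal diameter position. -/
def IsLowner (K : Set (E n)) : Prop :=
  ∀ T : E n →ₗ[ℝ] E n, |LinearMap.det T| = 1 →
    Metric.diam K ≤ Metric.diam (T '' K)

/-- The type-`s` constant of `X_K = (ℝⁿ, ‖·‖_K)`. -/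
def typeConst (K : Set (E n)) (s : ℝ) : ℝ :=
  sInf {T : ℝ | 0 < T ∧ ∀ m : ℕ, ∀ x : Fin m → E n,
    Real.sqrt (((2 : ℝ) ^ m)⁻¹ * ∑ ε : Fin m → Bool,
      gauge K (∑ i, (if ε i then (1 : ℝ) else -1) • x i) ^ 2) ≤
      T * (∑ i, gauge K (x i) ^ s) ^ (1 / s)}

/-- `X_K` is (isometric to) a subspace of a quotient of `L_p([0,1])`:
there is a closed submodule `N` of `L_p([0,1])` and a linear isometric embedding of
`(ℝⁿ, ‖·‖_K)` into the quotient `L_p([0,1]) ⧸ N` (with the quotient norm). -/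
def IsSubspaceOfQuotientOfLp (K : Set (E n)) (p : ℝ) (hp : 1 ≤ p) : Prop :=
  letI : Fact ((1 : ℝ≥0∞) ≤ ENNReal.ofReal p) := ⟨ENNReal.one_le_ofReal.mpr hp⟩
  ∃ N : Submodule ℝ (MeasureTheory.Lp ℝ (ENNReal.ofReal p) (volume.restrict (Icc (0 : ℝ) 1))),
    IsClosed (N : Set (MeasureTheory.Lp ℝ (ENNReal.ofReal p) (volume.restrict (Icc (0 : ℝ) 1)))) ∧
    ∃ J : E n →ₗ[ℝ]
      (MeasureTheory.Lp ℝ (ENNReal.ofReal p) (volume.restrict (Icc (0 : ℝ) 1)) ⧸ N),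
      ∀ x : E n, gauge K x = ‖J x‖

/-- `K` is isotropic with isotropic constant `L`. -/
def IsIsotropic (K : Set (E n)) (L : ℝ) : Prop :=
  volume K = 1 ∧ ∀ θ : E n, ‖θ‖ = 1 → (∫ x in K, ⟪x, θ⟫ ^ 2) = L ^ 2

/-- Entropy of `g` over `K`. -/
def entK (K : Set (E n)) (g : E n → ℝ) : ℝ :=
  (∫ x in K, g x * Real.log (g x)) - (∫ x in K, g x) * Real.log (∫ x in K, g x)

/-- `Var^q_K(f) = ∫_K |f - ∫_K f|^q`. -/
def varq (K : Set (E n)) (q : ℝ) (f : E n → ℝ) : ℝ :=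
  ∫ x in K, |f x - ∫ y in K, f y| ^ q

/-- The dual gauge `‖y‖_K^* = sup_{x ∈ K} ⟨x,y⟩`. -/
def dualGauge (K : Set (E n)) (y : E n) : ℝ :=
  sSup ((fun x : E n => ⟪x, y⟫) '' K)

/-- Half the mean width `M*(K)`. -/
def Mstar (K : Set (E n)) : ℝ := ∫ θ, dualGauge K θ ∂(sphMeasure n)

/-- Minimal mean-width position. -/
def IsMinMeanWidth (K : Set (E n)) : Prop :=
  ∀ T : E n →ₗ[ℝ] E n, |LinearMap.det T| = 1 → Mstar K ≤ Mstar (T '' K)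

/-- Positive definite symmetric linear map. -/
def IsPosDef (T : E n →ₗ[ℝ] E n) : Prop :=
  LinearMap.IsSymmetric T ∧ ∀ x : E n, x ≠ 0 → 0 < ⟪T x, x⟫

/-- Operator norm (w.r.t. the Euclidean norm). -/
def opNorm (T : E n →ₗ[ℝ] E n) : ℝ := ‖LinearMap.toContinuousLinearMap T‖

lemma body_nhds {K : Set (E n)} (hK : IsConvexBody K) : K ∈ nhds (0 : E n) := by
  obtain ⟨hc, hconv, ⟨x, hx⟩, hsym⟩ := hK
  have hx' : -x ∈ interior K := by
    have h : (Homeomorph.neg (E n)) ⁻¹' interior K = interior ((Homeomorph.neg (E n)) ⁻¹' K) :=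
      (Homeomorph.neg (E n)).preimage_interior K
    have h2 : (Homeomorph.neg (E n)) ⁻¹' K = K := by
      conv_rhs => rw [hsym]
      rfl
    rw [h2] at h
    rw [← h]; simpa using hx
  have := hconv.interior hx hx' (by norm_num : (0:ℝ) ≤ 1/2) (by norm_num : (0:ℝ) ≤ 1/2) (by norm_num)
  rw [smul_neg, add_neg_cancel] at this
  exact mem_interior_iff_mem_nhds.1 this

lemma body_norm_le {K : Set (E n)} (hK : IsConvexBody K) {x : E n} (hx : x ∈ K) :
    ‖x‖ ≤ Metric.diam K / 2 := by
  have hx' : -x ∈ K := by rw [hK.2.2.2]; simpa using hx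
  have h := Metric.dist_le_diam_of_mem hK.1.isBounded hx hx'
  rw [dist_eq_norm, sub_neg_eq_add, ← two_smul ℝ x, norm_smul] at h
  norm_num at h
  linarith

lemma mem_smul_of_gauge_le {K : Set (E n)} (hK : IsConvexBody K) {M : ℝ} (hM : 0 < M) {x : E n}
    (hx : gauge K x ≤ M) : x ∈ M • K := by
  have h1 : gauge K (M⁻¹ • x) ≤ 1 := by
    rw [gauge_smul_of_nonneg (inv_nonneg.2 hM.le), smul_eq_mul, inv_mul_le_iff₀ hM]
    simpa using hx
  rw [gauge_le_one_iff_mem_closure hK.2.1 (body_nhds hK), hK.1.isClosed.closure_eq] at h1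
  exact ⟨_, h1, by simp [smul_smul, hM.ne']⟩

lemma gauge_smul_le {K : Set (E n)} (hK : IsConvexBody K) {a : ℝ} (ha : |a| ≤ 1) {x : E n}
    (hx : x ∈ K) : gauge K (a • x) ≤ 1 := by
  have hx' : -x ∈ K := by rw [hK.2.2.2]; simpa using hx
  have h0 : (0 : E n) ∈ K := mem_of_mem_nhds (body_nhds hK)
  apply gauge_le_one_of_mem
  rcases le_total 0 a with h | h
  · rw [abs_of_nonneg h] at ha
    exact hK.2.1.smul_mem_of_zero_mem h0 hx ⟨h, ha⟩
  · rw [abs_of_nonpos h] at ha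
    have := hK.2.1.smul_mem_of_zero_mem h0 hx' (t := -a) ⟨by linarith, ha⟩
    simpa using this

lemma sign_sum (m : ℕ) (y : E n) (x : Fin m → E n) :
    ∑ ε : Fin m → Bool, ‖y + ∑ i, (if ε i then (1 : ℝ) else -1) • x i‖ ^ 2 =
      2 ^ m * (‖y‖ ^ 2 + ∑ i, ‖x i‖ ^ 2) := by
  induction m generalizing y with
  | zero => simp
  | succ m ih =>
    rw [← (Fin.consEquiv (fun _ => Bool)).sum_comp, Fintype.sum_prod_type]
    simp only [Fin.consEquiv_apply, Fin.sum_univ_succ, Fin.cons_zero, Fin.cons_succ, ← add_assoc]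
    simp only [ih]
    rw [Fintype.sum_bool]
    have := parallelogram_law_with_norm ℝ y (x 0)
    simp only [if_true, one_smul, Bool.false_eq_true, if_false, neg_smul, ← sub_eq_add_neg]
    rw [pow_succ]
    linear_combination (2:ℝ) ^ m * this

lemma sum_sq_le (m : ℕ) (a : Fin m → ℝ) (ha : ∀ i, 0 ≤ a i) {s : ℝ} (h1 : 1 ≤ s) (h2 : s ≤ 2) :
    ∑ i, a i ^ 2 ≤ ((∑ i, a i ^ s) ^ (1 / s)) ^ 2 := by
  set A := (∑ i, a i ^ s) ^ (1 / s) with hA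
  have hs : 0 < s := by linarith
  have hS : 0 ≤ ∑ i, a i ^ s := Finset.sum_nonneg fun i _ => rpow_nonneg (ha i) _
  have hA0 : 0 ≤ A := rpow_nonneg hS _
  have hAs : A ^ s = ∑ i, a i ^ s := by
    rw [hA, ← rpow_mul hS, one_div_mul_cancel hs.ne', rpow_one]
  have hle : ∀ i, a i ≤ A := fun i => by
    have : a i ^ s ≤ A ^ s := by
      rw [hAs]
      exact Finset.single_le_sum (f := fun i => a i ^ s)
        (fun i _ => rpow_nonneg (ha i) _) (Finset.mem_univ i)
    exact (rpow_le_rpow_iff (ha i) hA0 hs).1 this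
  have key : ∀ b : ℝ, 0 ≤ b → b ^ 2 = b ^ s * b ^ (2 - s) := fun b hb => by
    rw [← rpow_add_of_nonneg hb hs.le (by linarith)]
    simp
  calc ∑ i, a i ^ 2 = ∑ i, a i ^ s * a i ^ (2 - s) := by
        exact Finset.sum_congr rfl fun i _ => key _ (ha i)
    _ ≤ ∑ i, a i ^ s * A ^ (2 - s) := by
        apply Finset.sum_le_sum; intro i _
        exact mul_le_mul_of_nonneg_left (rpow_le_rpow (ha i) (hle i) (by linarith))
          (rpow_nonneg (ha i) _)
    _ = A ^ 2 := by rw [← Finset.sum_mul, ← hAs, ← key A hA0]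

/-- The type constant is finite. -/
lemma type_nonempty {K : Set (E n)} (hK : IsConvexBody K) {s : ℝ} (h1 : 1 ≤ s) (h2 : s ≤ 2) :
    {T : ℝ | 0 < T ∧ ∀ m : ℕ, ∀ x : Fin m → E n,
    Real.sqrt (((2 : ℝ) ^ m)⁻¹ * ∑ ε : Fin m → Bool,
      gauge K (∑ i, (if ε i then (1 : ℝ) else -1) • x i) ^ 2) ≤
      T * (∑ i, gauge K (x i) ^ s) ^ (1 / s)}.Nonempty := by
  obtain ⟨r, hr, hrK⟩ := Metric.mem_nhds_iff.1 (body_nhds hK)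
  set R := Metric.diam K / 2 + 1 with hR
  have hR0 : 0 < R := by have := Metric.diam_nonneg (s := K); positivity
  have hsub : K ⊆ Metric.closedBall 0 R := fun x hx => by
    have := body_norm_le hK hx
    simp; linarith
  have hup : ∀ x, gauge K x ≤ r⁻¹ * ‖x‖ := fun x => by
    rw [inv_mul_eq_div, le_div_iff₀ hr, mul_comm]; exact mul_gauge_le_norm hrK
  have hlo : ∀ x, ‖x‖ ≤ R * gauge K x := fun x => by
    have := le_gauge_of_subset_closedBall (x := x) (absorbent_nhds_zero (body_nhds hK)) hR0.le hsub
    rwa [div_le_iff₀' hR0] at this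
  refine ⟨r⁻¹ * R, by positivity, fun m x => ?_⟩
  have hG : ∀ x, 0 ≤ gauge K x := fun x => gauge_nonneg x
  have hB : 0 ≤ (∑ i, gauge K (x i) ^ s) ^ (1 / s) :=
    rpow_nonneg (Finset.sum_nonneg fun i _ => rpow_nonneg (hG _) _) _
  apply Real.sqrt_le_iff.2
  refine ⟨by positivity, ?_⟩
  rw [inv_mul_le_iff₀ (by positivity)]
  calc ∑ ε : Fin m → Bool, gauge K (∑ i, (if ε i then (1 : ℝ) else -1) • x i) ^ 2
      ≤ ∑ ε : Fin m → Bool, r⁻¹ ^ 2 * ‖0 + ∑ i, (if ε i then (1 : ℝ) else -1) • x i‖ ^ 2 := by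
        apply Finset.sum_le_sum; intro ε _
        rw [← mul_pow, zero_add]
        exact pow_le_pow_left₀ (hG _) (hup _) 2
    _ = r⁻¹ ^ 2 * (2 ^ m * ∑ i, ‖x i‖ ^ 2) := by
        rw [← Finset.mul_sum, sign_sum]; simp
    _ ≤ r⁻¹ ^ 2 * (2 ^ m * ∑ i, R ^ 2 * gauge K (x i) ^ 2) := by
        gcongr with i
        rw [← mul_pow]
        exact pow_le_pow_left₀ (norm_nonneg _) (hlo _) 2
    _ = r⁻¹ ^ 2 * (2 ^ m * (R ^ 2 * ∑ i, gauge K (x i) ^ 2)) := by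
        rw [← Finset.mul_sum (f := fun i => gauge K (x i) ^ 2)]
    _ ≤ r⁻¹ ^ 2 * (2 ^ m * (R ^ 2 * ((∑ i, gauge K (x i) ^ s) ^ (1 / s)) ^ 2)) := by
        gcongr
        exact sum_sq_le m _ (fun i => hG _) h1 h2
    _ = _ := by ring

/-- Volume bound: points of `K` span a parallelepiped of small volume. -/
lemma det_le {K : Set (E n)} (hK : IsConvexBody K) (hvol : volume K = 1) (hn : 0 < n)
    {s T : ℝ} (h1 : 1 ≤ s) (hT : 0 < T)
    (hT' : ∀ m : ℕ, ∀ x : Fin m → E n,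
    Real.sqrt (((2 : ℝ) ^ m)⁻¹ * ∑ ε : Fin m → Bool,
      gauge K (∑ i, (if ε i then (1 : ℝ) else -1) • x i) ^ 2) ≤
      T * (∑ i, gauge K (x i) ^ s) ^ (1 / s))
    (b : OrthonormalBasis (Fin n) ℝ (E n)) (x : Fin n → E n) (hx : ∀ i, x i ∈ K) :
    |b.toBasis.det x| ≤ (T * (n : ℝ) ^ (1 / s)) ^ n := by
  set M := T * (n : ℝ) ^ (1 / s) with hM
  have hn' : (0:ℝ) < n := by exact_mod_cast hn
  have hM0 : 0 < M := by positivity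
  let Q : Set (E n) := (WithLp.ofLp) ⁻¹' (Set.Icc (fun _ : Fin n => (-1:ℝ)) (fun _ => 1))
  have hQ : volume Q = 2 ^ n := by
    rw [(PiLp.volume_preserving_ofLp (Fin n)).measure_preimage
      (measurableSet_Icc.nullMeasurableSet), Real.volume_Icc_pi]
    norm_num
  let G : Set (E n) := {a | gauge K (∑ i, a i • x i) ≤ M}
  let S : (Fin n → Bool) → (E n ≃ₗᵢ[ℝ] E n) := fun ε =>
    LinearIsometryEquiv.piLpCongrRight 2
      (fun i => if ε i then LinearIsometryEquiv.refl ℝ ℝ else LinearIsometryEquiv.neg ℝ)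
  have hS : ∀ ε a i, S ε a i = (if ε i then (1:ℝ) else -1) * a i := by
    intro ε a i
    simp only [S, LinearIsometryEquiv.piLpCongrRight_apply]
    split_ifs <;> simp
  have hcov : Q ⊆ ⋃ ε, S ε ⁻¹' G := by
    intro a ha
    have ha' : ∀ i, |a i| ≤ 1 := fun i => abs_le.2 ⟨ha.1 i, ha.2 i⟩
    by_contra hcon
    simp only [Set.mem_iUnion, not_exists, Set.mem_preimage, G, Set.mem_ofPred_eq, not_le, hS] at hcon
    have h := hT' n (fun i => a i • x i)
    have hg : T * (∑ i, gauge K (a i • x i) ^ s) ^ (1 / s) ≤ M := by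
      have : ∑ i, gauge K (a i • x i) ^ s ≤ n := by
        calc ∑ i, gauge K (a i • x i) ^ s ≤ ∑ i : Fin n, (1:ℝ) := by
              apply Finset.sum_le_sum; intro i _
              exact rpow_le_one (gauge_nonneg _) (gauge_smul_le hK (ha' i) (hx i)) (by linarith)
          _ = n := by simp
      rw [hM]
      gcongr
      exact Finset.sum_nonneg fun i _ => rpow_nonneg (gauge_nonneg _) _
    have h := Real.sqrt_le_iff.1 (h.trans hg)
    have h := h.2
    rw [inv_mul_le_iff₀ (by positivity)] at h
    have hlt : ∑ ε : Fin n → Bool, M ^ 2 <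
        ∑ ε : Fin n → Bool, gauge K (∑ i, (if ε i then (1 : ℝ) else -1) • a i • x i) ^ 2 := by
      apply Finset.sum_lt_sum_of_nonempty Finset.univ_nonempty
      intro ε _
      have := hcon ε
      simp only [mul_smul] at this
      exact pow_lt_pow_left₀ this hM0.le two_ne_zero
    rw [Finset.sum_const, Finset.card_univ, nsmul_eq_mul] at hlt
    simp only [Fintype.card_fun, Fintype.card_bool, Fintype.card_fin] at hlt
    push_cast at hlt
    linarith
  have hG : 1 ≤ volume G := by
    have h : volume Q ≤ 2 ^ n * volume G := by
      calc volume Q ≤ ∑ ε : Fin n → Bool, volume (S ε ⁻¹' G) :=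
            (measure_mono hcov).trans (measure_iUnion_fintype_le _ _)
        _ = ∑ ε : Fin n → Bool, volume G := by
            apply Finset.sum_congr rfl; intro ε _
            exact (S ε).measurePreserving.measure_preimage_equiv (f := (S ε).toMeasurableEquiv) G
        _ = 2 ^ n * volume G := by simp
    rw [hQ] at h
    by_contra hcon
    push Not at hcon
    have : (2:ℝ≥0∞) ^ n * volume G < 2 ^ n * 1 :=
      (ENNReal.mul_lt_mul_iff_right (by positivity) (by finiteness)).2 hcon
    rw [mul_one] at this
    exact absurd h (not_le.2 this)
  let L : E n →ₗ[ℝ] E n := b.toBasis.constr ℝ x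
  have hdet : LinearMap.det L = b.toBasis.det x := by
    have h := b.toBasis.det_comp L b.toBasis
    rw [Module.Basis.det_self, mul_one] at h
    rw [← h]
    congr 1
    ext1 i
    simp [L]
  have hsub : L '' (b.repr ⁻¹' G) ⊆ M • K := by
    rintro _ ⟨y, hy, rfl⟩
    apply mem_smul_of_gauge_le hK hM0
    have : L y = ∑ i, b.repr y i • x i := by
      simp [L, Module.Basis.constr_apply_fintype]
    rw [this]; exact hy
  have h := measure_mono (μ := volume) hsub
  have hrG : volume (b.repr ⁻¹' G) = volume G :=
    b.repr.measurePreserving.measure_preimage_equiv (f := b.repr.toMeasurableEquiv) G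
  rw [Measure.addHaar_image_linearMap, Measure.addHaar_smul, hvol, hdet, mul_one,
    hrG,
    finrank_euclideanSpace_fin, abs_of_pos (pow_pos hM0 n)] at h
  have h' : ENNReal.ofReal |b.toBasis.det x| ≤ ENNReal.ofReal (M ^ n) :=
    le_trans (by simpa using mul_le_mul_right hG (ENNReal.ofReal |b.toBasis.det x|)) h
  exact (ENNReal.ofReal_le_ofReal_iff (by positivity)).1 h'

lemma det_two (F : Submodule ℝ (E n)) (α β : ℝ) :
    LinearMap.det (α • LinearMap.id + (β - α) • (F.starProjection : E n →ₗ[ℝ] E n)) =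
      β ^ Module.finrank ℝ F * α ^ Module.finrank ℝ Fᗮ := by
  let e := F.prodEquivOfIsCompl _ F.isCompl_orthogonal
  rw [← LinearMap.det_conj _ e.symm]
  have : (e.symm : E n →ₗ[ℝ] _) ∘ₗ
      (α • LinearMap.id + (β - α) • (F.starProjection : E n →ₗ[ℝ] E n)) ∘ₗ
      (e.symm.symm : _ →ₗ[ℝ] E n) =
      LinearMap.prodMap (β • (LinearMap.id : F →ₗ[ℝ] F)) (α • (LinearMap.id : Fᗮ →ₗ[ℝ] Fᗮ)) := by
    apply LinearMap.ext
    rintro ⟨u, v⟩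
    simp only [LinearMap.comp_apply, LinearEquiv.coe_coe]
    rw [LinearEquiv.symm_apply_eq]
    have h1 : F.starProjection (u : E n) = u := F.starProjection_eq_self_iff.2 u.2
    have h2 : F.starProjection (v : E n) = 0 := F.starProjection_apply_eq_zero_iff.2 v.2
    simp [e, h1, h2]
    module
  rw [this, LinearMap.det_prodMap, LinearMap.det_smul, LinearMap.det_smul]
  simp

/-- Dvoretzky–Rogers type lemma. -/
lemma exists_big_proj {K : Set (E n)} (hK : IsConvexBody K) (hL : IsLowner K)
    (F : Submodule ℝ (E n)) :
    ∃ x ∈ K, (Module.finrank ℝ F : ℝ) / n * (Metric.diam K / 2) ^ 2 ≤ ‖F.starProjection x‖ ^ 2 := by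
  have h0 : (0 : E n) ∈ K := mem_of_mem_nhds (body_nhds hK)
  obtain ⟨x, hxK, hx⟩ := hK.1.exists_isMaxOn (f := fun x => ‖F.starProjection x‖ ^ 2) ⟨0, h0⟩
    (by fun_prop)
  refine ⟨x, hxK, ?_⟩
  set R := Metric.diam K / 2 with hR
  have hR0 : 0 ≤ R := by have := Metric.diam_nonneg (s := K); positivity
  set A := ‖F.starProjection x‖ ^ 2 with hA
  have hA0 : 0 ≤ A := by positivity
  have hAR : A ≤ R ^ 2 := by
    have h1 := F.norm_starProjection_apply_le x
    have h2 := body_norm_le hK hxK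
    exact pow_le_pow_left₀ (norm_nonneg _) (h1.trans h2) 2
  set m := Module.finrank ℝ F with hm
  set k := Module.finrank ℝ Fᗮ with hk
  have hmk : m + k = n := by simpa using F.finrank_add_finrank_orthogonal
  have main : ∀ t : ℝ, 0 ≤ t → R ^ 2 ≤ exp (-(2 * t * m)) * (R ^ 2 - A) + exp (2 * t * k) * A := by
    intro t ht
    let α := exp (-(t * m))
    let β := exp (t * k)
    have hα : 0 < α := exp_pos _
    have hβ : 0 < β := exp_pos _
    have hα2 : α ^ 2 = exp (-(2 * t * m)) := by
      simp only [α]; rw [← exp_nat_mul]; congr 1; push_cast; ring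
    have hβ2 : β ^ 2 = exp (2 * t * k) := by
      simp only [β]; rw [← exp_nat_mul]; congr 1; push_cast; ring
    have hle : α ^ 2 ≤ β ^ 2 := by
      rw [hα2, hβ2, exp_le_exp]
      have h1 : 0 ≤ 2 * t * m := by positivity
      have h2 : 0 ≤ 2 * t * k := by positivity
      linarith
    let U : E n →ₗ[ℝ] E n := α • LinearMap.id + (β - α) • (F.starProjection : E n →ₗ[ℝ] E n)
    have hU : |LinearMap.det U| = 1 := by
      rw [det_two, ← hm, ← hk]
      simp only [α, β]
      rw [← exp_nat_mul, ← exp_nat_mul, ← exp_add]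
      have : (m:ℝ) * (t * k) + k * (-(t * m)) = 0 := by ring
      rw [this]; simp
    rw [← hα2, ← hβ2]
    set B := α ^ 2 * (R ^ 2 - A) + β ^ 2 * A with hB
    have hB0 : 0 ≤ B := by
      have : 0 ≤ R ^ 2 - A := by linarith
      positivity
    have hUn : ∀ y ∈ K, ‖U y‖ ≤ √B := by
      intro y hy
      apply Real.le_sqrt_of_sq_le
      have e1 : U y = β • F.starProjection y + α • Fᗮ.starProjection y := by
        have := F.starProjection_add_starProjection_orthogonal y
        have h2 : Fᗮ.starProjection y = y - F.starProjection y := by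
          rw [eq_sub_iff_add_eq, add_comm]; exact this
        rw [h2]
        simp [U]
        module
      have e2 : ‖U y‖ ^ 2 = β ^ 2 * ‖F.starProjection y‖ ^ 2 + α ^ 2 * ‖Fᗮ.starProjection y‖ ^ 2 := by
        rw [e1, sq, norm_add_sq_eq_norm_sq_add_norm_sq_of_inner_eq_zero (𝕜 := ℝ), norm_smul, norm_smul,
          Real.norm_of_nonneg hα.le, Real.norm_of_nonneg hβ.le]
        · ring
        · rw [inner_smul_left, inner_smul_right,
            (F.mem_orthogonal _).1 (Fᗮ.starProjection_apply_mem y) _ (F.starProjection_apply_mem y)]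
          simp
      have e3 := F.norm_sq_eq_add_norm_sq_starProjection y
      have e4 : ‖F.starProjection y‖ ^ 2 ≤ A := hx hy
      have e5 : ‖y‖ ^ 2 ≤ R ^ 2 := pow_le_pow_left₀ (norm_nonneg _) (body_norm_le hK hy) 2
      rw [e2, hB]
      have e6 : ‖Fᗮ.starProjection y‖ ^ 2 = ‖y‖ ^ 2 - ‖F.starProjection y‖ ^ 2 := by linarith
      rw [e6]
      nlinarith [mul_nonneg (sub_nonneg.2 hle) (sub_nonneg.2 e4),
        mul_nonneg (sq_nonneg α) (sub_nonneg.2 e5)]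
    have hd : Metric.diam (U '' K) ≤ 2 * √B := by
      apply Metric.diam_le_of_forall_dist_le (by positivity)
      rintro _ ⟨y, hy, rfl⟩ _ ⟨z, hz, rfl⟩
      rw [dist_eq_norm]
      have := norm_sub_le (U y) (U z)
      linarith [hUn y hy, hUn z hz]
    have h := hL U hU
    have hRB : R ≤ √B := by rw [hR]; linarith
    calc R ^ 2 ≤ √B ^ 2 := pow_le_pow_left₀ hR0 hRB 2
      _ = B := Real.sq_sqrt hB0
  rcases Nat.eq_zero_or_pos n with hn | hn
  · have : (n:ℝ) = 0 := by exact_mod_cast hn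
    rw [this]; simpa using hA0
  have hn' : (0:ℝ) < n := by exact_mod_cast hn
  have hmk' : (m:ℝ) + k = n := by exact_mod_cast hmk
  rw [div_mul_eq_mul_div, div_le_iff₀ hn']
  have hm0 : (0:ℝ) ≤ m := by positivity
  have hk0 : (0:ℝ) ≤ k := by positivity
  have step : ∀ t : ℝ, 0 < t → 2 * t * k < 1 → m * R ^ 2 ≤ A * n + 2 * t * (m * k * R ^ 2) := by
    intro t ht htk
    have h := main t ht.le
    have p1 : 0 < 1 + 2 * t * m := by positivity
    have p2 : 0 < 1 - 2 * t * k := by linarith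
    have b1 : exp (-(2 * t * m)) ≤ (1 + 2 * t * m)⁻¹ := by
      rw [exp_neg]
      apply inv_anti₀ p1
      linarith [add_one_le_exp (2 * t * m)]
    have b2 : exp (2 * t * k) ≤ (1 - 2 * t * k)⁻¹ := by
      have := one_sub_le_exp_neg (2 * t * k)
      rw [exp_neg] at this
      exact (le_inv_comm₀ p2 (exp_pos _)).1 this
    have h2 : R ^ 2 ≤ (1 + 2 * t * m)⁻¹ * (R ^ 2 - A) + (1 - 2 * t * k)⁻¹ * A := by
      have q : 0 ≤ R ^ 2 - A := by linarith
      exact h.trans (add_le_add (mul_le_mul_of_nonneg_right b1 q) (mul_le_mul_of_nonneg_right b2 hA0))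
    have h3 := mul_le_mul_of_nonneg_right h2 (mul_pos p1 p2).le
    have h4 : ((1 + 2 * t * m)⁻¹ * (R ^ 2 - A) + (1 - 2 * t * k)⁻¹ * A) *
        ((1 + 2 * t * m) * (1 - 2 * t * k)) =
        (1 - 2 * t * k) * (R ^ 2 - A) + (1 + 2 * t * m) * A := by
      field_simp
    rw [h4] at h3
    have h5 : 0 ≤ 2 * t * (A * n + 2 * t * (m * k * R ^ 2) - m * R ^ 2) := by
      rw [← hmk']; nlinarith [h3]
    have := nonneg_of_mul_nonneg_right h5 (by positivity)
    linarith
  have lim : Filter.Tendsto (fun t : ℝ => A * n + 2 * t * (m * k * R ^ 2)) (nhdsWithin 0 (Set.Ioi 0))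
      (nhds (A * n + 2 * 0 * (m * k * R ^ 2))) := by
    apply Filter.Tendsto.mono_left _ nhdsWithin_le_nhds
    exact Continuous.tendsto (by fun_prop) 0
  have lim2 : ∀ᶠ t : ℝ in nhdsWithin 0 (Set.Ioi 0), 2 * t * k < 1 := by
    apply nhdsWithin_le_nhds
    have : Filter.Tendsto (fun t : ℝ => 2 * t * k) (nhds 0) (nhds (2 * 0 * k)) :=
      Continuous.tendsto (by fun_prop) 0
    exact this.eventually_lt_const (by norm_num)
  have := ge_of_tendsto lim (by
    filter_upwards [lim2, self_mem_nhdsWithin] with t h1 h2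
    exact step t h2 h1)
  simpa using this

/-- Greedy choice of vectors. -/
lemma exists_greedy (g : Submodule ℝ (E n) → E n) :
    ∃ f : Fin n → E n, ∀ i, f i = g (Submodule.span ℝ (f '' Set.Iio i))ᗮ := by
  let f : Fin n → E n := (wellFounded_lt (α := Fin n)).fix
    (fun i rec => g (Submodule.span ℝ (Set.range fun j : Set.Iio i => rec j.1 j.2))ᗮ)
  refine ⟨f, fun i => ?_⟩
  simp only [f]
  rw [WellFounded.fix_eq]
  congr 3
  rw [Set.image_eq_range]

lemma exists_big_det {K : Set (E n)} (hK : IsConvexBody K) (hL : IsLowner K)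
    (hd : 0 < Metric.diam K) :
    ∃ (b : OrthonormalBasis (Fin n) ℝ (E n)) (x : Fin n → E n), (∀ i, x i ∈ K) ∧
      ∏ i : Fin n, (((n - i : ℕ) : ℝ) / n * (Metric.diam K / 2) ^ 2) ≤ (b.toBasis.det x) ^ 2 := by
  choose g hgK hg using exists_big_proj hK hL
  obtain ⟨f, hf⟩ := exists_greedy g
  have hdim : Module.finrank ℝ (E n) = Fintype.card (Fin n) := by simp
  refine ⟨InnerProductSpace.gramSchmidtOrthonormalBasis hdim f, f, fun i => by rw [hf]; exact hgK _, ?_⟩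
  rw [InnerProductSpace.gramSchmidtOrthonormalBasis_det, ← Finset.prod_pow]
  apply Finset.prod_le_prod
  · intro i _; positivity
  intro i _
  set V := Submodule.span ℝ (f '' Set.Iio i) with hV
  set w := InnerProductSpace.gramSchmidt ℝ f i with hw
  have hdiff : f i - w ∈ V := by
    rw [hV, ← InnerProductSpace.span_gramSchmidt_Iio]
    have : f i - w = ∑ j ∈ Finset.Iio i,
        (ℝ ∙ InnerProductSpace.gramSchmidt ℝ f j).starProjection (f i) := by
      rw [sub_eq_iff_eq_add, add_comm]; exact InnerProductSpace.gramSchmidt_def' ℝ f i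
    rw [this]
    apply Submodule.sum_mem
    intro j hj
    have h1 := (ℝ ∙ InnerProductSpace.gramSchmidt ℝ f j).starProjection_apply_mem (f i)
    refine Submodule.span_mono ?_ h1
    rintro _ rfl
    exact ⟨j, by simpa using hj, rfl⟩
  have hworth : w ∈ Vᗮ := by
    rw [hV, Submodule.mem_orthogonal']
    intro u hu
    induction hu using Submodule.span_induction with
    | mem y hy =>
      obtain ⟨j, hj, rfl⟩ := hy
      exact InnerProductSpace.gramSchmidt_inv_triangular ℝ f hj
    | zero => simp
    | add y z _ _ hy hz => rw [inner_add_right, hy, hz, add_zero]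
    | smul c y _ hy => rw [inner_smul_right, hy, mul_zero]
  have hproj : Vᗮ.starProjection (f i) = w := by
    have h1 : Vᗮ.starProjection (f i - w) = 0 :=
      Vᗮ.starProjection_apply_eq_zero_iff.2 (V.le_orthogonal_orthogonal hdiff)
    have h2 : Vᗮ.starProjection w = w := Vᗮ.starProjection_eq_self_iff.2 hworth
    rw [map_sub, h2, sub_eq_zero] at h1
    exact h1
  have hrank : n - (i : ℕ) ≤ Module.finrank ℝ Vᗮ := by
    have h1 := V.finrank_add_finrank_orthogonal
    have h2 : Module.finrank ℝ V ≤ i := by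
      have : f '' Set.Iio i = ((Finset.Iio i).image f : Finset (E n)) := by simp
      rw [hV, this]
      refine (finrank_span_finset_le_card _).trans ?_
      refine Finset.card_image_le.trans ?_
      simp
    have h3 : Module.finrank ℝ (E n) = n := by simp
    omega
  have hi := i.2
  have hn : (0:ℝ) < n := by exact_mod_cast (by omega : 0 < n)
  have hle : ((n - i : ℕ) : ℝ) / n * (Metric.diam K / 2) ^ 2 ≤ ‖w‖ ^ 2 := by
    have h := hg Vᗮ
    rw [← hf i, hproj] at h
    refine le_trans ?_ h
    gcongr
  have hwpos : 0 < ‖w‖ ^ 2 := by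
    refine lt_of_lt_of_le ?_ hle
    have : (0:ℝ) < ((n - i : ℕ) : ℝ) := by exact_mod_cast (by omega : 0 < n - (i:ℕ))
    positivity
  have hw0 : w ≠ 0 := by
    intro h; rw [h] at hwpos; simp at hwpos
  have hN : InnerProductSpace.gramSchmidtNormed ℝ f i ≠ 0 := by
    simp [InnerProductSpace.gramSchmidtNormed, ← hw, hw0]
  rw [InnerProductSpace.gramSchmidtOrthonormalBasis_apply hdim hN]
  have hin : ⟪w, f i⟫ = ‖w‖ ^ 2 := by
    have h1 : ⟪w, f i - w⟫ = 0 := by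
      rw [real_inner_comm]
      exact (V.mem_orthogonal _).1 hworth _ hdiff
    rw [inner_sub_right, real_inner_self_eq_norm_sq] at h1
    linarith
  have : ⟪InnerProductSpace.gramSchmidtNormed ℝ f i, f i⟫ = ‖w‖ := by
    rw [InnerProductSpace.gramSchmidtNormed, ← hw, inner_smul_left, hin]
    have : ‖w‖ ≠ 0 := by simpa using hw0
    simp
    field_simp
  rw [this]
  exact hle

lemma prod_eq_fact (n : ℕ) : ∏ i : Fin n, ((n - i : ℕ) : ℝ) = (n.factorial : ℝ) := by
  rw [Fin.prod_univ_eq_prod_range (fun i => ((n - i : ℕ) : ℝ)) n, ← Nat.cast_prod]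
  congr 1
  rw [← Finset.prod_range_add_one_eq_factorial, ← Finset.prod_range_reflect]
  apply Finset.prod_congr rfl
  intro i hi
  simp at hi
  omega

/-- diameter bound in Löwner position via type. -/
theorem lowner_diam_le_type :
    ∃ C > (0 : ℝ),
      ∀ (n : ℕ) (K : Set (E n)), IsConvexBody K → volume K = 1 → IsLowner K →
        ∀ s : ℝ, 1 ≤ s → s ≤ 2 →
          Metric.diam K ≤ C * (n : ℝ) ^ (1 / s) * typeConst K s := by
  refine ⟨4, by norm_num, ?_⟩
  intro n K hK hvol hL s h1 h2
  rcases Nat.eq_zero_or_pos n with hn | hn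
  · subst hn
    have : Metric.diam K = 0 := Metric.diam_subsingleton (Set.subsingleton_of_subsingleton)
    rw [this]
    have : (1 / s) ≠ 0 := by positivity
    rw [Nat.cast_zero, Real.zero_rpow this]; simp
  have hn' : (0:ℝ) < n := by exact_mod_cast hn
  have hp : 0 < 4 * (n : ℝ) ^ (1 / s) := by positivity
  rw [← div_le_iff₀' hp]
  apply le_csInf (type_nonempty hK h1 h2)
  rintro T ⟨hT, hT'⟩
  rw [div_le_iff₀' hp]
  rcases (Metric.diam_nonneg (s := K)).eq_or_lt with hd | hd
  · rw [← hd]; positivity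
  obtain ⟨b, x, hxK, hdet⟩ := exists_big_det hK hL hd
  have hle := det_le hK hvol hn h1 hT hT' b x hxK
  set M := T * (n : ℝ) ^ (1 / s) with hM
  have hM0 : 0 < M := by positivity
  set R := Metric.diam K / 2 with hR
  have hR0 : 0 < R := by positivity
  have hsq : (b.toBasis.det x) ^ 2 ≤ (M ^ n) ^ 2 := by
    rw [← sq_abs]; exact pow_le_pow_left₀ (abs_nonneg _) hle 2
  have hprod : ∏ i : Fin n, (((n - i : ℕ) : ℝ) / n * R ^ 2) =
      (n.factorial : ℝ) / (n:ℝ) ^ n * (R ^ 2) ^ n := by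
    rw [Finset.prod_mul_distrib, Finset.prod_div_distrib, prod_eq_fact]
    simp
  rw [hprod] at hdet
  have hexp := Real.pow_div_factorial_le_exp (n:ℝ) hn'.le n
  have hexp4 : exp (n:ℝ) ≤ 4 ^ n := by
    rw [← mul_one (n:ℝ), exp_nat_mul]
    exact pow_le_pow_left₀ (exp_pos _).le (by linarith [Real.exp_one_lt_d9]) n
  have hf : (0:ℝ) < n.factorial := by exact_mod_cast n.factorial_pos
  have h4 : (1/4 : ℝ) ^ n ≤ (n.factorial : ℝ) / (n:ℝ) ^ n := by
    rw [div_pow, one_pow, div_le_div_iff₀ (by positivity) (by positivity), one_mul]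
    have := hexp.trans hexp4
    rw [div_le_iff₀ hf] at this
    linarith
  have h5 : (1/4 * R ^ 2) ^ n ≤ (M ^ 2) ^ n := by
    calc (1/4 * R ^ 2) ^ n = (1/4 : ℝ) ^ n * (R ^ 2) ^ n := by rw [mul_pow]
      _ ≤ (n.factorial : ℝ) / (n:ℝ) ^ n * (R ^ 2) ^ n := by gcongr
      _ ≤ (M ^ n) ^ 2 := hdet.trans hsq
      _ = (M ^ 2) ^ n := by ring
  have h6 : 1/4 * R ^ 2 ≤ M ^ 2 :=
    (pow_le_pow_iff_left₀ (by positivity) (by positivity) hn.ne').1 h5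
  have h7 : R ≤ 2 * M := by
    nlinarith [h6, hR0, hM0]
  have : Metric.diam K = 2 * R := by rw [hR]; ring
  rw [this, mul_assoc, mul_comm ((n:ℝ) ^ (1/s)) T, ← hM]
  linarith

end GM
end
end

section
/- There exist universal constants c, C > 0 such that: if K ⊂ ℝⁿ is a p-convex body with constant α which is isotropic with isotropic constant L_K, then c (α n)^{1/p} L_K D_n ⊆ K, where D_n is the Euclidean unit ball; in particular L_K ≤ C n^{1/2 − 1/p} α^{−1/p}. -/
open MeasureTheory Real Set
open scoped ENNReal RealInnerProductSpace Pointwise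

noncomputable section

namespace GM

variable {n : ℕ}

lemma bm_compact {A B : Set ℝ} (hA : IsCompact A) (hB : IsCompact B) (hA' : A.Nonempty)
    (hB' : B.Nonempty) (S : Set ℝ) (hS : ∀ x ∈ A, ∀ y ∈ B, x + y ∈ S) :
    volume A + volume B ≤ volume S := by
  have ha := hA.sSup_mem hA'
  have hb := hB.sInf_mem hB'
  set a := sSup A
  set b := sInf B
  have h1 : volume ((fun x => x + b) '' A) = volume A := by
    simp
  have h2 : volume ((fun x => a + x) '' B) = volume B := by
    simp
  have hm1 : MeasurableSet ((fun x => a + x) '' B) :=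
    (hB.image (by fun_prop)).measurableSet
  have h3 := measure_union_add_inter (μ := volume) ((fun x => x + b) '' A) hm1
  have h4 : volume ((fun x => x + b) '' A ∩ (fun x => a + x) '' B) = 0 := by
    refine measure_mono_null (t := {a + b}) ?_ (by simp)
    rintro z ⟨⟨x, hx, rfl⟩, ⟨y, hy, hxy⟩⟩
    have := le_csSup hA.bddAbove hx
    have := csInf_le hB.bddBelow hy
    simp only [mem_singleton_iff] at *
    change x ≤ a at *
    linarith
  rw [h4, add_zero, h1, h2] at h3
  rw [← h3]
  refine measure_mono ?_
  rintro z (⟨x, hx, rfl⟩ | ⟨y, hy, rfl⟩)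
  · exact hS _ hx _ hb
  · exact hS _ ha _ hy

lemma bm_meas {A B : Set ℝ} (hA : MeasurableSet A) (hB : MeasurableSet B) (hA' : A.Nonempty)
    (hB' : B.Nonempty) (S : Set ℝ) (hS : ∀ x ∈ A, ∀ y ∈ B, x + y ∈ S) :
    volume A + volume B ≤ volume S := by
  obtain ⟨a, ha⟩ := hA'
  obtain ⟨b, hb⟩ := hB'
  rw [hA.measure_eq_iSup_isCompact, hB.measure_eq_iSup_isCompact]
  simp only [iSup_and']
  refine ENNReal.biSup_add_biSup_le' (p := fun K => K ⊆ A ∧ IsCompact K)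
    (q := fun K => K ⊆ B ∧ IsCompact K) ⟨∅, by simp⟩ ⟨∅, by simp⟩ ?_
  intro P hP Q hQ
  refine le_trans (add_le_add (measure_mono (subset_insert a P)) (measure_mono (subset_insert b Q)))
    (bm_compact (hP.2.insert a) (hQ.2.insert b) (by simp) (by simp) S ?_)
  intro x hx y hy
  exact hS x (insert_subset ha hP.1 hx) y (insert_subset hb hQ.1 hy)

lemma pl_real {f g h : ℝ → ℝ} (hf : Measurable f) (hg : Measurable g) (hh : Measurable h)
    (f0 : ∀ x, 0 ≤ f x) (g0 : ∀ x, 0 ≤ g x) (h0 : ∀ x, 0 ≤ h x)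
    (f1 : ∀ x, f x ≤ 1) (g1 : ∀ x, g x ≤ 1)
    (f2 : ∀ t < 1, ∃ x, t < f x) (g2 : ∀ t < 1, ∃ x, t < g x)
    (H : ∀ x y, f x * g y ≤ h ((2⁻¹ : ℝ) • (x + y)) ^ 2) :
    (∫⁻ x, ENNReal.ofReal (f x)) + ∫⁻ x, ENNReal.ofReal (g x) ≤
      2 * ∫⁻ x, ENNReal.ofReal (h x) := by
  rw [lintegral_eq_lintegral_meas_lt _ (.of_forall f0) hf.aemeasurable,
    lintegral_eq_lintegral_meas_lt _ (.of_forall g0) hg.aemeasurable,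
    lintegral_eq_lintegral_meas_lt _ (.of_forall h0) hh.aemeasurable]
  have anti : ∀ u : ℝ → ℝ, Measurable fun t => volume {a | t < u a} := fun u =>
    Antitone.measurable (fun s t hst => measure_mono fun x hx => lt_of_le_of_lt hst hx)
  rw [← lintegral_add_left (anti f), ← lintegral_const_mul _ (anti h)]
  refine setLIntegral_mono ((anti h).const_mul 2) ?_
  intro t ht
  simp only [mem_Ioi] at ht
  rcases lt_or_ge t 1 with h1 | h1
  · have key := bm_meas (hf measurableSet_Ioi : MeasurableSet (f ⁻¹' Ioi t))
      (hg measurableSet_Ioi : MeasurableSet (g ⁻¹' Ioi t)) (f2 t h1) (g2 t h1)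
      ((2 : ℝ) • {a | t < h a}) ?_
    · refine key.trans ?_
      rw [Measure.addHaar_smul]
      simp
    · intro x hx y hy
      rw [mem_smul_set_iff_inv_smul_mem₀ two_ne_zero]
      simp only [mem_preimage, mem_Ioi] at hx hy
      show t < h _
      have := H x y
      refine lt_of_pow_lt_pow_left₀ 2 (h0 _) (lt_of_lt_of_le ?_ this)
      nlinarith
  · have e1 : {a | t < f a} = ∅ := by
      ext x; simpa using (f1 x).trans h1
    have e2 : {a | t < g a} = ∅ := by
      ext x; simpa using (g1 x).trans h1
    simp [e1, e2]

lemma ennreal_amgm {a b c : ℝ≥0∞} (h : a + b ≤ 2 * c) : a * b ≤ c ^ 2 := by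
  by_cases hc : c = ∞
  · simp [hc]
  have h2 : 2 * c ≠ ∞ := ENNReal.mul_ne_top (by simp) hc
  have ha : a ≠ ∞ := ne_top_of_le_ne_top h2 (le_self_add.trans h)
  have hb : b ≠ ∞ := ne_top_of_le_ne_top h2 (le_add_self.trans h)
  lift a to NNReal using ha
  lift b to NNReal using hb
  lift c to NNReal using hc
  norm_cast at *
  have : (a : ℝ) + b ≤ 2 * c := by exact_mod_cast h
  have : (a : ℝ) * b ≤ c ^ 2 := by nlinarith [sq_nonneg ((a : ℝ) - b), a.2, b.2, c.2]
  exact_mod_cast this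

lemma pl_bdd {f g h : ℝ → ℝ≥0∞} (hf : Measurable f) (hg : Measurable g) (hh : Measurable h)
    (N : ℝ≥0∞) (hN : N ≠ ∞) (f1 : ∀ x, f x ≤ N) (g1 : ∀ x, g x ≤ N)
    (H : ∀ x y, f x * g y ≤ h ((2⁻¹ : ℝ) • (x + y)) ^ 2) :
    (∫⁻ x, f x) * ∫⁻ x, g x ≤ (∫⁻ x, h x) ^ 2 := by
  set F := ⨆ x, f x with hF
  set G := ⨆ x, g x with hG
  have fF : ∀ x, f x ≤ F := fun x => le_iSup f x
  have gG : ∀ x, g x ≤ G := fun x => le_iSup g x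
  have Ft : F ≠ ∞ := ne_top_of_le_ne_top hN (iSup_le f1)
  have Gt : G ≠ ∞ := ne_top_of_le_ne_top hN (iSup_le g1)
  by_cases F0 : F = 0
  · have : ∀ x, f x = 0 := fun x => le_antisymm (F0 ▸ fF x) bot_le
    simp [this]
  by_cases G0 : G = 0
  · have : ∀ x, g x = 0 := fun x => le_antisymm (G0 ▸ gG x) bot_le
    simp [this]
  obtain ⟨S, hS⟩ : ∃ S : ℝ≥0∞, S ^ 2 = F * G := ⟨(F * G) ^ (1/2 : ℝ), by
    rw [← ENNReal.rpow_natCast, ← ENNReal.rpow_mul]; simp⟩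
  have S0 : S ≠ 0 := by rintro rfl; simp [F0, G0] at hS
  have St : S ≠ ∞ := by
    rintro rfl; exact ENNReal.mul_ne_top Ft Gt (by rw [← hS]; simp)
  have fd : ∀ x, f x / F ≤ 1 := fun x => ENNReal.div_le_of_le_mul (by simpa using fF x)
  have gd : ∀ x, g x / G ≤ 1 := fun x => ENNReal.div_le_of_le_mul (by simpa using gG x)
  have fdt : ∀ x, f x / F ≠ ∞ := fun x => ne_top_of_le_ne_top ENNReal.one_ne_top (fd x)
  have gdt : ∀ x, g x / G ≠ ∞ := fun x => ne_top_of_le_ne_top ENNReal.one_ne_top (gd x)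
  have hdt : ∀ x, min (h x / S) 1 ≠ ∞ := fun x =>
    ne_top_of_le_ne_top ENNReal.one_ne_top (min_le_right _ _)
  have supaux : ∀ (u : ℝ → ℝ≥0∞) (U : ℝ≥0∞), U = (⨆ x, u x) → U ≠ 0 → U ≠ ∞ →
      (∀ x, u x / U ≠ ∞) → ∀ t < (1:ℝ), ∃ x, t < (u x / U).toReal := by
    intro u U hU U0 Ut hut t ht
    rcases lt_or_ge t 0 with h0 | h0
    · exact ⟨0, h0.trans_le ENNReal.toReal_nonneg⟩
    have : ENNReal.ofReal t * U < ⨆ x, u x := by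
      rw [← hU]
      calc _ < 1 * U := ENNReal.mul_lt_mul_left U0 Ut (by simpa using ht)
        _ = U := one_mul _
    obtain ⟨x, hx⟩ := lt_iSup_iff.1 this
    refine ⟨x, ?_⟩
    rw [← ENNReal.ofReal_lt_iff_lt_toReal h0 (hut x)]
    exact (ENNReal.lt_div_iff_mul_lt (.inl U0) (.inl Ut)).2 hx
  have key := pl_real (f := fun x => (f x / F).toReal) (g := fun x => (g x / G).toReal)
    (h := fun x => (min (h x / S) 1).toReal) (by fun_prop) (by fun_prop) (by fun_prop)
    (fun _ => ENNReal.toReal_nonneg) (fun _ => ENNReal.toReal_nonneg)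
    (fun _ => ENNReal.toReal_nonneg)
    (fun x => ENNReal.toReal_le_of_le_ofReal zero_le_one (by simpa using fd x))
    (fun x => ENNReal.toReal_le_of_le_ofReal zero_le_one (by simpa using gd x))
    (supaux f F hF F0 Ft fdt) (supaux g G hG G0 Gt gdt) ?_
  · simp only [ENNReal.ofReal_toReal (fdt _), ENNReal.ofReal_toReal (gdt _),
      ENNReal.ofReal_toReal (hdt _)] at key
    have k2 : (∫⁻ x, f x / F) + ∫⁻ x, g x / G ≤ 2 * ∫⁻ x, h x / S := by
      refine key.trans ?_
      gcongr
      exact min_le_left _ _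
    have k3 := ennreal_amgm k2
    simp only [div_eq_mul_inv] at k3
    rw [lintegral_mul_const _ hf, lintegral_mul_const _ hg, lintegral_mul_const _ hh] at k3
    have k4 : (F * G) * ((∫⁻ x, f x) * F⁻¹ * ((∫⁻ x, g x) * G⁻¹)) ≤
      S^2 * ((∫⁻ x, h x) * S⁻¹) ^ 2 := by rw [hS]; gcongr
    calc (∫⁻ x, f x) * ∫⁻ x, g x = (F * F⁻¹) * (G * G⁻¹) * ((∫⁻ x, f x) * ∫⁻ x, g x) := by
          rw [ENNReal.mul_inv_cancel F0 Ft, ENNReal.mul_inv_cancel G0 Gt]; simp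
      _ = (F * G) * ((∫⁻ x, f x) * F⁻¹ * ((∫⁻ x, g x) * G⁻¹)) := by ring
      _ ≤ _ := k4
      _ = (S * S⁻¹) ^ 2 * (∫⁻ x, h x) ^ 2 := by ring
      _ = _ := by rw [ENNReal.mul_inv_cancel S0 St]; simp
  · intro x y
    rw [← ENNReal.toReal_mul, ← ENNReal.toReal_pow]
    refine ENNReal.toReal_mono (ENNReal.pow_ne_top (hdt _)) ?_
    rcases le_total (h ((2⁻¹ : ℝ) • (x + y)) / S) 1 with h1 | h1
    · rw [min_eq_left h1]
      calc f x / F * (g y / G) = (f x * g y) * (F⁻¹ * G⁻¹) := by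
            simp only [div_eq_mul_inv]; ring
        _ = (f x * g y) * (F * G)⁻¹ := by
            rw [ENNReal.mul_inv (.inl F0) (.inl Ft)]
        _ ≤ h ((2⁻¹ : ℝ) • (x + y)) ^ 2 * (F * G)⁻¹ := by gcongr; exact H x y
        _ = _ := by rw [← hS, ENNReal.inv_pow, div_eq_mul_inv]; ring
    · rw [min_eq_right h1]
      calc f x / F * (g y / G) ≤ 1 * 1 := mul_le_mul' (fd x) (gd y)
        _ = _ := by simp

lemma pl_one {f g h : ℝ → ℝ≥0∞} (hf : Measurable f) (hg : Measurable g) (hh : Measurable h)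
    (H : ∀ x y, f x * g y ≤ h ((2⁻¹ : ℝ) • (x + y)) ^ 2) :
    (∫⁻ x, f x) * ∫⁻ x, g x ≤ (∫⁻ x, h x) ^ 2 := by
  have aux : ∀ u : ℝ → ℝ≥0∞, Measurable u →
      ∫⁻ x, u x = ⨆ N : ℕ, ∫⁻ x, min (u x) N := by
    intro u hu
    rw [← lintegral_iSup (f := fun (N : ℕ) x => min (u x) (N : ℝ≥0∞))
      (fun N => hu.min measurable_const)
      (fun M N hMN x => min_le_min_left _ (by exact_mod_cast hMN))]
    congr 1; ext x
    rw [← inf_iSup_eq, ENNReal.iSup_natCast]; simp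
  rw [aux f hf, aux g hg, ENNReal.iSup_mul]
  refine iSup_le fun M => ?_
  rw [ENNReal.mul_iSup]
  refine iSup_le fun N => ?_
  refine pl_bdd (hf.min measurable_const) (hg.min measurable_const) hh (max M N) (by simp)
    (fun x => (min_le_right _ _).trans (le_max_left _ _))
    (fun x => (min_le_right _ _).trans (le_max_right _ _)) ?_
  intro x y
  exact (mul_le_mul' (min_le_left _ _) (min_le_left _ _)).trans (H x y)

lemma pl_pi (n : ℕ) : ∀ {f g h : (Fin n → ℝ) → ℝ≥0∞} (hf : Measurable f) (hg : Measurable g)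
    (hh : Measurable h)
    (H : ∀ x y, f x * g y ≤ h ((2⁻¹ : ℝ) • (x + y)) ^ 2),
    (∫⁻ x, f x) * ∫⁻ x, g x ≤ (∫⁻ x, h x) ^ 2 := by
  induction n with
  | zero =>
    intro f g h hf hg hh H
    have := H 0 0
    simpa [Measure.volume_pi_eq_dirac (0 : Fin 0 → ℝ), lintegral_dirac] using this
  | succ n ih =>
    intro f g h hf hg hh H
    let e := MeasurableEquiv.piFinSuccAbove (fun _ : Fin (n+1) => ℝ) 0
    have he : MeasurePreserving e.symm := (volume_preserving_piFinSuccAbove (fun _ => ℝ) 0).symm e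
    have aux : ∀ u : (Fin (n+1) → ℝ) → ℝ≥0∞, Measurable u →
        ∫⁻ x, u x = ∫⁻ s, ∫⁻ y, u (e.symm (s, y)) := by
      intro u hu
      rw [← he.lintegral_comp hu, Measure.volume_eq_prod, lintegral_prod _ (by fun_prop)]
    have hm : ∀ u : (Fin (n+1) → ℝ) → ℝ≥0∞, Measurable u →
        Measurable fun s => ∫⁻ y, u (e.symm (s, y)) := by
      intro u hu
      exact Measurable.lintegral_prod_right' (f := fun z => u (e.symm z)) (by fun_prop)
    rw [aux f hf, aux g hg, aux h hh]
    refine pl_one (hm f hf) (hm g hg) (hm h hh) ?_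
    intro s t
    refine ih (by fun_prop) (by fun_prop) (by fun_prop) ?_
    intro x y
    convert H (e.symm (s, x)) (e.symm (t, y)) using 3
    ext i
    refine Fin.cases ?_ (fun j => ?_) i <;>
    simp [e, MeasurableEquiv.piFinSuccAbove, Fin.insertNthEquiv, mul_add]

lemma bm_euclid {n : ℕ} {A B M : Set (EuclideanSpace ℝ (Fin n))} (hA : MeasurableSet A)
    (hB : MeasurableSet B) (hM : MeasurableSet M)
    (H : ∀ x ∈ A, ∀ y ∈ B, (2⁻¹ : ℝ) • (x + y) ∈ M) :
    volume A * volume B ≤ volume M ^ 2 := by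
  have mp := PiLp.volume_preserving_toLp (Fin n)
  rw [← mp.measure_preimage hA.nullMeasurableSet, ← mp.measure_preimage hB.nullMeasurableSet,
    ← mp.measure_preimage hM.nullMeasurableSet]
  have mA := mp.measurable hA
  have mB := mp.measurable hB
  have mM := mp.measurable hM
  rw [← lintegral_indicator_one mA, ← lintegral_indicator_one mB, ← lintegral_indicator_one mM]
  refine pl_pi n (measurable_one.indicator mA) (measurable_one.indicator mB)
    (measurable_one.indicator mM) ?_
  intro x y
  by_cases hx : WithLp.toLp 2 x ∈ A
  · by_cases hy : WithLp.toLp 2 y ∈ B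
    · have := H _ hx _ hy
      rw [indicator_of_mem (by exact hx), indicator_of_mem (by exact hy), indicator_of_mem]
      · simp
      · simpa using this
    · rw [indicator_of_notMem (s := _ ⁻¹' B) (by exact hy)]; simp
  · rw [indicator_of_notMem (s := _ ⁻¹' A) (by exact hx)]; simp
section body
variable {K : Set (E n)}

lemma mem_nhds_zero (hK : IsConvexBody K) : K ∈ nhds (0 : E n) := by
  obtain ⟨-, hc, ⟨x, hx⟩, hs⟩ := hK
  have hx' : -x ∈ K := by rw [hs]; simpa using interior_subset hx
  have := hc.openSegment_interior_self_subset_interior hx hx'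
  rw [← mem_interior_iff_mem_nhds]
  refine this ⟨1/2, 1/2, by norm_num, by norm_num, by norm_num, by simp⟩

lemma mem_iff (hK : IsConvexBody K) (x : E n) : gauge K x ≤ 1 ↔ x ∈ K := by
  rw [gauge_le_one_iff_mem_closure hK.2.1 (mem_nhds_zero hK), hK.1.isClosed.closure_eq]

lemma gauge_pos' (hK : IsConvexBody K) {x : E n} (hx : x ≠ 0) : 0 < gauge K x :=
  (gauge_pos (absorbent_nhds_zero (mem_nhds_zero hK)) (NormedSpace.isVonNBounded_of_isBounded ℝ hK.1.isBounded)).2 hx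
    
lemma gauge_sm {a : ℝ} (ha : 0 ≤ a) (x : E n) : gauge K (a • x) = a * gauge K x := by
  rw [gauge_smul_of_nonneg ha, smul_eq_mul]

lemma inner_le (hK : IsConvexBody K) {θ : E n} {h : ℝ} (hh : ∀ x ∈ K, ⟪x, θ⟫ ≤ h) (z : E n) :
    ⟪z, θ⟫ ≤ h * gauge K z := by
  by_cases hz : z = 0
  · subst hz; simp
  have hp := gauge_pos' hK hz
  have : (gauge K z)⁻¹ • z ∈ K := by
    rw [← mem_iff hK, gauge_sm (inv_nonneg.2 hp.le), inv_mul_cancel₀ hp.ne']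
  have := hh _ this
  rw [real_inner_smul_left, inv_mul_le_iff₀ hp] at this
  linarith

lemma modConv_le (hK : IsConvexBody K) {ε : ℝ} {x y : E n} (hx : x ∈ K) (hy : y ∈ K)
    (hxy : ε ≤ gauge K (x - y)) : modConv K ε ≤ 1 - gauge K ((2⁻¹ : ℝ) • (x + y)) := by
  refine csInf_le ⟨0, ?_⟩ ⟨x, y, (mem_iff hK x).2 hx, (mem_iff hK y).2 hy, hxy, rfl⟩
  rintro d ⟨a, b, ha, hb, -, rfl⟩
  rw [mem_iff hK] at ha hb
  have : (2⁻¹ : ℝ) • (a + b) ∈ K := by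
    rw [smul_add]; exact hK.2.1 ha hb (by norm_num) (by norm_num) (by norm_num)
  rw [← mem_iff hK] at this
  linarith

lemma dim_pos {p α : ℝ} (hα : 0 < α) (hK : IsPConvexBody K p α) : n ≠ 0 := by
  rintro rfl
  have := hK.2 1 one_pos (by norm_num)
  have e : modConv K 1 = 0 := by
    unfold modConv
    convert Real.sInf_empty
    ext d
    simp only [mem_ofPred_eq, mem_empty_iff_false, iff_false]
    rintro ⟨x, y, -, -, h, -⟩
    rw [Subsingleton.elim (x - y) 0, gauge_zero] at h
    linarith
  rw [e, Real.one_rpow] at this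
  linarith

lemma p_ge_one {p α : ℝ} (hα : 0 < α) (hK : IsPConvexBody K p α) : 1 ≤ p := by
  have hn := dim_pos hα hK
  obtain ⟨x, hx⟩ : ∃ x : E n, x ≠ 0 := by
    have : Nonempty (Fin n) := ⟨⟨0, Nat.pos_of_ne_zero hn⟩⟩
    exact exists_ne 0
  have hp := gauge_pos' hK.1 hx
  obtain ⟨u, hu⟩ : ∃ u : E n, gauge K u = 1 :=
    ⟨(gauge K x)⁻¹ • x, by rw [gauge_sm (inv_nonneg.2 hp.le), inv_mul_cancel₀ hp.ne']⟩
  have key : ∀ ε : ℝ, 0 < ε → ε ≤ 1 → α * ε ^ p ≤ ε / 2 := by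
    intro ε h0 h1
    have huK : u ∈ K := (mem_iff hK.1 u).1 hu.le
    have hy : (1 - ε) • u ∈ K := by
      rw [← mem_iff hK.1, gauge_sm (by linarith), hu]; linarith
    have := modConv_le hK.1 (ε := ε) huK hy ?_
    · have h3 : (2⁻¹ : ℝ) • (u + (1 - ε) • u) = (1 - ε / 2) • u := by module
      rw [h3, gauge_sm (by linarith), hu] at this
      have := hK.2 ε h0 (by linarith)
      linarith
    · have h3 : u - (1 - ε) • u = ε • u := by module
      rw [h3, gauge_sm h0.le, hu, mul_one]
  by_contra! hlt
  have ht := (tendsto_rpow_neg_nhdsGT_zero (y := p - 1) (by linarith)).eventually_gt_atTop α⁻¹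
  obtain ⟨ε, h1, h2, h3⟩ := (ht.and (Ioo_mem_nhdsGT (zero_lt_one' ℝ))).exists
  have k := key ε h2 h3.le
  have : ε ^ p = ε ^ (p - 1) * ε := by
    rw [Real.rpow_sub_one h2.ne', div_mul_cancel₀ _ h2.ne']
  rw [this] at k
  have k2 : 1 < α * ε ^ (p - 1) := by
    rw [inv_lt_iff_one_lt_mul₀ hα] at h1; linarith
  nlinarith

lemma tail {p α : ℝ} (hα : 0 < α) (hK : IsPConvexBody K p α) (hv : volume K = 1)
    {θ : E n} {h : ℝ} (h0 : 0 < h) (hh : ∀ x ∈ K, ⟪x, θ⟫ ≤ h) {t : ℝ} (t0 : 0 < t) :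
    volume {x ∈ K | t ≤ ⟪x, θ⟫} ≤ ENNReal.ofReal (Real.exp (-(n * (α * (2 * t / h) ^ p)))) := by
  rcases lt_or_ge h t with hlt | hle
  · have : {x ∈ K | t ≤ ⟪x, θ⟫} = ∅ := by
      ext x
      simp only [mem_ofPred_eq, mem_empty_iff_false, iff_false, not_and, not_le]
      exact fun hx => (hh x hx).trans_lt hlt
    simp [this]
  set ε := 2 * t / h with hε
  have ε0 : 0 < ε := by positivity
  have ε2 : ε ≤ 2 := by rw [hε, div_le_iff₀ h0]; linarith
  have hm := hK.2 ε ε0 ε2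
  set A := {x ∈ K | t ≤ ⟪x, θ⟫} with hA
  have neg : ∀ x ∈ K, -x ∈ K := by
    intro x hx; have := hK.1.2.2.2; rw [this]; simpa using hx
  have cA : IsClosed A := hK.1.1.isClosed.inter (isClosed_le (f := fun _ : E n => t)
    (g := fun x => ⟪x, θ⟫) continuous_const (by fun_prop))
  set q := 1 - α * ε ^ p with hq
  have mid : ∀ x ∈ A, ∀ y ∈ -A, gauge K ((2⁻¹ : ℝ) • (x + y)) ≤ q := by
    intro x hx y hy
    have hy' : -y ∈ A := hy
    have hyK : y ∈ K := by simpa using neg _ hy'.1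
    have := modConv_le hK.1 (ε := ε) hx.1 hyK ?_
    · linarith
    · have h1 := inner_le hK.1 hh (x - y)
      have h2 := hx.2
      have h3 := hy'.2
      rw [inner_sub_left] at h1
      rw [inner_neg_left] at h3
      rw [hε, div_le_iff₀ h0]
      linarith
  rcases A.eq_empty_or_nonempty with he | ⟨a, ha⟩
  · simp [he]
  have q0 : 0 ≤ q := (gauge_nonneg _).trans (mid a ha (-a) (by simpa using ha))
  have bm := bm_euclid (A := A) (B := -A) (M := {z | gauge K z ≤ q}) cA.measurableSet
    cA.neg.measurableSet (measurableSet_le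
      (continuous_gauge hK.1.2.1 (mem_nhds_zero hK.1)).measurable measurable_const) mid
  rw [Measure.measure_neg, ← pow_two] at bm
  have bm2 : volume A ≤ volume {z | gauge K z ≤ q} := by
    by_contra! hlt
    exact absurd bm (not_le.2 (ENNReal.pow_lt_pow_left two_ne_zero hlt))
  have hsub : {z | gauge K z ≤ q} ⊆ q • K := by
    intro z hz
    rcases q0.eq_or_lt with hq0 | hq0
    · have : z = 0 := by
        by_contra hne
        have := gauge_pos' hK.1 hne
        simp only [mem_ofPred_eq] at hz
        linarith
      subst this
      exact ⟨0, mem_of_mem_nhds (mem_nhds_zero hK.1), by simp⟩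
    · rw [mem_smul_set_iff_inv_smul_mem₀ hq0.ne', ← mem_iff hK.1,
        gauge_sm (inv_nonneg.2 hq0.le), inv_mul_le_iff₀ hq0]
      simpa using hz
  refine (bm2.trans (measure_mono hsub)).trans ?_
  rw [Measure.addHaar_smul_of_nonneg _ q0, hv, mul_one]
  refine ENNReal.ofReal_le_ofReal ?_
  have : q ≤ Real.exp (-(α * ε ^ p)) := by
    have := Real.add_one_le_exp (-(α * ε ^ p)); linarith
  calc q ^ _ ≤ Real.exp (-(α * ε ^ p)) ^ n := by
        simp only [finrank_euclideanSpace, Fintype.card_fin]; gcongr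
    _ = _ := by rw [← Real.exp_nat_mul]; congr 1; ring

lemma key_bound {p α L : ℝ} (hα : 0 < α) (hL : 0 < L) (hK : IsPConvexBody K p α)
    (hI : IsIsotropic K L) {θ : E n} (hθ : ‖θ‖ = 1) {h : ℝ} (h0 : 0 < h)
    (hh : ∀ x ∈ K, ⟪x, θ⟫ ≤ h) : 1 / 2 * (α * n) ^ (1 / p) * L ≤ h := by
  have hn : (0 : ℝ) < n := by
    have := dim_pos hα hK; positivity
  have hp := p_ge_one hα hK
  set R := (α * n) ^ (1 / p) with hR
  have R0 : 0 < R := by positivity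
  have Rp : R ^ p = α * n := by
    rw [hR, ← Real.rpow_mul (by positivity), one_div_mul_cancel (by linarith), Real.rpow_one]
  have mK : MeasurableSet K := hK.1.1.measurableSet
  have neg : ∀ x ∈ K, -x ∈ K := by
    intro x hx; have := hK.1.2.2.2; rw [this]; simpa using hx
  set κ := 2 * R / h with hκ
  have κ0 : 0 < κ := by positivity
  -- the normalised variable
  let Y : E n → ℝ := fun x => κ * |⟪x, θ⟫|
  have Yc : Continuous Y := by fun_prop
  have tailY : ∀ s : ℝ, 0 < s → (volume.restrict K) {x | s ≤ Y x} ≤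
      ENNReal.ofReal (2 * Real.exp 1 * Real.exp (-s)) := by
    intro s s0
    rcases le_total s 1 with hs | hs
    · calc (volume.restrict K) {x | s ≤ Y x} ≤ (volume.restrict K) univ := measure_mono (subset_univ _)
        _ = ENNReal.ofReal 1 := by simp [hI.1]
        _ ≤ _ := by
          apply ENNReal.ofReal_le_ofReal
          rw [mul_assoc, ← Real.exp_add]
          have := Real.add_one_le_exp (1 + -s)
          linarith
    · have hm : MeasurableSet {x | s ≤ Y x} := (isClosed_le continuous_const Yc).measurableSet
      rw [Measure.restrict_apply hm]
      have t0 : 0 < s / κ := by positivity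
      set A := {x ∈ K | s / κ ≤ ⟪x, θ⟫} with hA
      have hT := tail hα hK hI.1 h0 hh t0
      have hsub : {x | s ≤ Y x} ∩ K ⊆ A ∪ -A := by
        rintro x ⟨hx, hxK⟩
        have hx2 : s / κ ≤ |⟪x, θ⟫| := by
          rw [div_le_iff₀ κ0]; have : s ≤ κ * |⟪x, θ⟫| := hx; linarith
        rcases le_abs.1 hx2 with h1 | h1
        · exact .inl ⟨hxK, h1⟩
        · exact .inr ⟨neg _ hxK, by rw [inner_neg_left]; exact h1⟩
      have e1 : Real.exp (-(n * (α * (2 * (s / κ) / h) ^ p))) ≤ Real.exp 1 * Real.exp (-s) := by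
        rw [← Real.exp_add]
        apply Real.exp_le_exp.2
        have : 2 * (s / κ) / h = s / R := by rw [hκ]; field_simp
        rw [this, Real.div_rpow s0.le R0.le, Rp]
        have e2 : (n : ℝ) * (α * (s ^ p / (α * n))) = s ^ p := by field_simp
        rw [e2]
        have := Real.rpow_le_rpow_of_exponent_le hs hp
        rw [Real.rpow_one] at this
        linarith
      calc volume ({x | s ≤ Y x} ∩ K) ≤ volume (A ∪ -A) := measure_mono hsub
        _ ≤ volume A + volume (-A) := measure_union_le _ _
        _ = volume A + volume A := by rw [Measure.measure_neg]
        _ ≤ ENNReal.ofReal (Real.exp 1 * Real.exp (-s)) + ENNReal.ofReal (Real.exp 1 * Real.exp (-s)) := by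
          have := hT.trans (ENNReal.ofReal_le_ofReal e1)
          gcongr
        _ = _ := by rw [← ENNReal.ofReal_add (by positivity) (by positivity)]; congr 1; ring
  have lc := lintegral_rpow_eq_lintegral_meas_le_mul (volume.restrict K) (f := Y)
    (.of_forall fun x => by positivity) Yc.aemeasurable (p := 2) two_pos
  have G1 : ∫⁻ t in Ioi (0:ℝ), ENNReal.ofReal (Real.exp (-t) * t ^ ((2:ℝ) - 1)) = 1 := by
    rw [← ofReal_integral_eq_lintegral_ofReal (Real.GammaIntegral_convergent two_pos),
      ← Real.Gamma_eq_integral two_pos, Real.Gamma_two, ENNReal.ofReal_one]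
    filter_upwards [ae_restrict_mem measurableSet_Ioi] with t ht
    have : (0:ℝ) < t := ht
    positivity
  have up : ∫⁻ x in K, ENNReal.ofReal (Y x ^ (2:ℝ)) ≤ ENNReal.ofReal (4 * Real.exp 1) := by
    rw [lc]
    calc _ ≤ ENNReal.ofReal 2 * ∫⁻ t in Ioi (0:ℝ), ENNReal.ofReal (2 * Real.exp 1) *
            ENNReal.ofReal (Real.exp (-t) * t ^ ((2:ℝ) - 1)) := by
          gcongr ENNReal.ofReal 2 * ?_
          refine setLIntegral_mono (by fun_prop) fun t ht => ?_
          rw [ENNReal.ofReal_mul (Real.exp_pos _).le, ← mul_assoc, ← ENNReal.ofReal_mul (by positivity)]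
          gcongr
          exact tailY t ht
      _ = _ := by
          rw [lintegral_const_mul _ (by fun_prop), G1, mul_one, ← ENNReal.ofReal_mul (by norm_num)]
          congr 1; ring
  have int : IntegrableOn (fun x => (κ ^ 2 * ⟪x, θ⟫ ^ 2)) K :=
    (Continuous.continuousOn (by fun_prop)).integrableOn_compact hK.1.1
  have eqY : ∀ x, Y x ^ (2:ℝ) = κ ^ 2 * ⟪x, θ⟫ ^ 2 := by
    intro x; simp only [Y]; rw [Real.rpow_two, mul_pow, sq_abs]
  simp only [eqY] at up
  rw [← ofReal_integral_eq_lintegral_ofReal int (.of_forall fun x => by positivity),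
    ENNReal.ofReal_le_ofReal_iff (by positivity), integral_const_mul, hI.2 θ hθ] at up
  have e3 : Real.exp 1 ≤ 4 := by linarith [Real.exp_one_lt_d9]
  have : (κ * L) ^ 2 ≤ 4 ^ 2 := by rw [mul_pow]; linarith
  have := le_of_sq_le_sq this (by norm_num)
  rw [hκ, div_mul_eq_mul_div, div_le_iff₀ h0] at this
  linarith

lemma ball_sub {p α L : ℝ} (hα : 0 < α) (hL : 0 < L) (hK : IsPConvexBody K p α)
    (hI : IsIsotropic K L) :
    (1 / 2 * (α * n) ^ (1 / p) * L) • Metric.closedBall (0 : E n) 1 ⊆ K := by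
  set r := 1 / 2 * (α * n) ^ (1 / p) * L with hr
  have r0 : 0 ≤ r := by positivity
  rintro _ ⟨x, hx, rfl⟩
  simp only [Metric.mem_closedBall, dist_zero_right] at hx
  by_contra hxK
  obtain ⟨f, u, hf, hu⟩ := geometric_hahn_banach_closed_point hK.1.2.1 hK.1.1.isClosed hxK
  obtain ⟨v, rfl⟩ := (InnerProductSpace.toDual ℝ (E n)).surjective f
  simp only [InnerProductSpace.toDual_apply_apply] at hf hu
  have u0 : 0 < u := by simpa using hf 0 (mem_of_mem_nhds (mem_nhds_zero hK.1))
  have v0 : 0 < ‖v‖ := by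
    rw [norm_pos_iff]; rintro rfl; simp at hu; linarith
  have := key_bound hα hL hK hI (θ := ‖v‖⁻¹ • v)
    (by rw [norm_smul, norm_inv, norm_norm, inv_mul_cancel₀ v0.ne']) (h := u / ‖v‖) (by positivity)
    (fun a ha => by
      rw [real_inner_smul_right, real_inner_comm, div_eq_inv_mul]
      have := (hf a ha).le
      gcongr)
  rw [← hr, le_div_iff₀ v0] at this
  have h2 : ⟪v, r • x⟫ ≤ ‖v‖ * (r * ‖x‖) := by
    refine (real_inner_le_norm _ _).trans ?_
    rw [norm_smul, Real.norm_of_nonneg r0]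
  have h3 : r * ‖x‖ ≤ r := mul_le_of_le_one_right r0 hx
  nlinarith

lemma rad_le (hv : volume K = 1) (hn : n ≠ 0) {r : ℝ} (hr : 0 < r)
    (hs : r • Metric.closedBall (0 : E n) 1 ⊆ K) : r ≤ Real.sqrt n := by
  have hn' : (0 : ℝ) < n := by positivity
  have sn : 0 < Real.sqrt n := Real.sqrt_pos.2 hn'
  by_contra! hlt
  -- the cube of side `2` in the ball of radius `sqrt n`
  set Q : Set (Fin n → ℝ) := Set.pi univ fun _ => Icc (-1 : ℝ) 1
  have hQ : volume Q = 2 ^ n := by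
    rw [volume_pi_pi]; norm_num [Real.volume_Icc]
  have mp := PiLp.volume_preserving_ofLp (Fin n)
  have hQm : MeasurableSet Q := MeasurableSet.univ_pi fun _ => measurableSet_Icc
  have e : volume ((WithLp.ofLp : E n → _) ⁻¹' Q) = 2 ^ n := by
    rw [mp.measure_preimage hQm.nullMeasurableSet, hQ]
  have sub : (WithLp.ofLp : E n → _) ⁻¹' Q ⊆ K := by
    intro x hx
    refine hs ?_
    rw [mem_smul_set_iff_inv_smul_mem₀ hr.ne']
    simp only [Metric.mem_closedBall, dist_zero_right, norm_smul, norm_inv, Real.norm_of_nonneg hr.le]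
    rw [inv_mul_le_iff₀ hr, mul_one]
    refine le_trans ?_ hlt.le
    rw [EuclideanSpace.norm_eq]
    apply Real.sqrt_le_sqrt
    calc ∑ i, ‖x i‖ ^ 2 ≤ ∑ i : Fin n, (1 : ℝ) := by
          refine Finset.sum_le_sum fun i _ => ?_
          have := hx i (mem_univ i)
          rw [Real.norm_eq_abs, sq_abs]
          nlinarith [this.1, this.2]
      _ = n := by simp
  have := measure_mono (μ := volume) sub
  rw [e, hv] at this
  have h2 : (1 : ℝ≥0∞) < 2 ^ n := one_lt_pow₀ (by norm_num) hn
  exact absurd this (not_le.2 h2)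

end body

/-- inscribed ball for isotropic `p`-convex bodies. -/
theorem p_convex_isotropic_inscribed_ball :
    ∃ c > (0 : ℝ), ∃ C > (0 : ℝ),
      ∀ (n : ℕ) (K : Set (E n)) (p α L : ℝ), 0 < α → 0 < L →
        IsPConvexBody K p α → IsIsotropic K L →
        (c * (α * n) ^ (1 / p) * L) • Metric.closedBall (0 : E n) 1 ⊆ K ∧
        L ≤ C * (n : ℝ) ^ ((1 : ℝ) / 2 - 1 / p) * α ^ (-(1 / p)) := by
  refine ⟨1 / 2, by norm_num, 2, by norm_num, ?_⟩
  intro n K p α L hα hL hK hI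
  have hs := ball_sub hα hL hK hI
  refine ⟨hs, ?_⟩
  have hn := dim_pos hα hK
  have hn' : (0 : ℝ) < n := by positivity
  have := rad_le hI.1 hn (by positivity) hs
  rw [Real.mul_rpow hα.le hn'.le] at this
  rw [Real.rpow_sub hn', Real.rpow_neg hα.le, ← Real.sqrt_eq_rpow]
  have a0 : 0 < α ^ (1 / p) := by positivity
  have b0 : 0 < (n : ℝ) ^ (1 / p) := by positivity
  rw [mul_div_assoc', ← div_eq_mul_inv, div_div, le_div_iff₀ (by positivity)]
  linarith

end GM
end
end
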